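/- The rewrite system R_DEO is convergent, i.e. terminating and confluent, and it generates the equational theory H_DEO: two terms are equal modulo H_DEO if and only if they have the same R_DEO-normal form. -/

import Mathlib

set_option maxHeartbeats 1000000

namespace Paper

/-- First-order terms over a signature `Sg` with arities `ar`, with free
constants (indexed by `ℕ`) and variables (indexed by `ℕ`). -/
inductive Tm (Sg : Type) (ar : Sg → ℕ) : Type where
  | var : ℕ → Tm Sg ar
  | cst : ℕ → Tm Sg ar
  | app : (s : Sg) → (Fin (ar s) → Tm Sg ar) → Tm Sg ar

variable {Sg : Type} {ar : Sg → ℕ}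

/-- Substitutions. -/
abbrev Subst (Sg : Type) (ar : Sg → ℕ) := ℕ → Tm Sg ar

/-- Application of a substitution to a term. -/
def subst (σ : Subst Sg ar) : Tm Sg ar → Tm Sg ar
  | .var n => σ n
  | .cst c => .cst c
  | .app s a => .app s (fun i => subst σ (a i))

/-- Composition of substitutions: `scomp τ σ` first applies `σ`, then `τ`. -/
def scomp (τ σ : Subst Sg ar) : Subst Sg ar := fun n => subst τ (σ n)

def isVar : Tm Sg ar → Prop
  | .var _ => True
  | _ => False

def isVarB : Tm Sg ar → Bool
  | .var _ => true
  | _ => false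

/-- The set of variables of a term. -/
def vars : Tm Sg ar → Set ℕ
  | .var n => {n}
  | .cst _ => ∅
  | .app _ a => ⋃ i, vars (a i)

/-- A term is ground if it has no variables. -/
def Ground (t : Tm Sg ar) : Prop := vars t = ∅

/-- The subterm of `t` at position `p` (a sequence of argument indices). -/
def subtermAt : Tm Sg ar → List ℕ → Option (Tm Sg ar)
  | t, [] => some t
  | .var _, _ :: _ => none
  | .cst _, _ :: _ => none
  | .app s a, i :: p => if h : i < ar s then subtermAt (a ⟨i, h⟩) p else none

/-- Replacement of the subterm at position `p` by `u`. -/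
def replaceAt : Tm Sg ar → List ℕ → Tm Sg ar → Tm Sg ar
  | _, [], u => u
  | .var n, _ :: _, _ => .var n
  | .cst c, _ :: _, _ => .cst c
  | .app s a, i :: p, u => .app s (fun j => if j.1 = i then replaceAt (a j) p u else a j)

/-- The set of subterms of a term. -/
def subterms (t : Tm Sg ar) : Set (Tm Sg ar) := {u | ∃ p, subtermAt t p = some u}

/-- The number of symbols of a term. -/
def tmSize : Tm Sg ar → ℕ
  | .var _ => 1
  | .cst _ => 1
  | .app _ a => 1 + Finset.univ.sum (fun i => tmSize (a i))

/-- One-step rewriting with the rules `R` (closed under substitution and contexts). -/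
inductive Rew (R : Tm Sg ar → Tm Sg ar → Prop) : Tm Sg ar → Tm Sg ar → Prop where
  | root : ∀ (l r : Tm Sg ar) (σ : Subst Sg ar), R l r → Rew R (subst σ l) (subst σ r)
  | congr : ∀ (s : Sg) (a b : Fin (ar s) → Tm Sg ar) (i : Fin (ar s)),
      Rew R (a i) (b i) → (∀ j, j ≠ i → a j = b j) → Rew R (Tm.app s a) (Tm.app s b)

/-- The reflexive-transitive closure of rewriting. -/
def Reduces (R : Tm Sg ar → Tm Sg ar → Prop) : Tm Sg ar → Tm Sg ar → Prop :=
  Relation.ReflTransGen (Rew R)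

/-- A term is in normal form if no rewriting step applies to it. -/
def NormalForm (R : Tm Sg ar → Tm Sg ar → Prop) (t : Tm Sg ar) : Prop := ∀ u, ¬ Rew R t u

/-- A substitution is in normal form if all its images are. -/
def NormalSubst (R : Tm Sg ar → Tm Sg ar → Prop) (σ : Subst Sg ar) : Prop :=
  ∀ n, NormalForm R (σ n)

/-- Termination of rewriting: no infinite rewriting sequences. -/
def Terminating (R : Tm Sg ar → Tm Sg ar → Prop) : Prop :=
  WellFounded (fun a b : Tm Sg ar => Rew R b a)

/-- Confluence of rewriting. -/
def Confluent (R : Tm Sg ar → Tm Sg ar → Prop) : Prop :=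
  ∀ a b c : Tm Sg ar, Reduces R a b → Reduces R a c →
    ∃ d, Reduces R b d ∧ Reduces R c d

/-- Convergence: termination together with confluence. -/
def Convergent (R : Tm Sg ar → Tm Sg ar → Prop) : Prop := Terminating R ∧ Confluent R

/-- The equational theory generated by a set of axioms `A`: the smallest
congruence containing all substitution instances of the axioms. -/
inductive EqTh (A : Tm Sg ar → Tm Sg ar → Prop) : Tm Sg ar → Tm Sg ar → Prop where
  | ax : ∀ (l r : Tm Sg ar) (σ : Subst Sg ar), A l r → EqTh A (subst σ l) (subst σ r)
  | refl : ∀ t, EqTh A t t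
  | symm : ∀ {t u}, EqTh A t u → EqTh A u t
  | trans : ∀ {t u v}, EqTh A t u → EqTh A u v → EqTh A t v
  | congr : ∀ (s : Sg) (a b : Fin (ar s) → Tm Sg ar),
      (∀ i, EqTh A (a i) (b i)) → EqTh A (Tm.app s a) (Tm.app s b)

/-- `σ` unifies `u` and `v` syntactically. -/
def Unifies (σ : Subst Sg ar) (u v : Tm Sg ar) : Prop := subst σ u = subst σ v

/-- `σ` is a most general (syntactic) unifier of `u` and `v`. -/
def IsMGU (σ : Subst Sg ar) (u v : Tm Sg ar) : Prop :=
  Unifies σ u v ∧ ∀ τ, Unifies τ u v → ∃ ρ, ∀ n, τ n = subst ρ (σ n)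

def UnifiesSys (σ : Subst Sg ar) (S : List (Tm Sg ar × Tm Sg ar)) : Prop :=
  ∀ e ∈ S, subst σ e.1 = subst σ e.2

/-- `σ` is a most general (syntactic) unifier of the system `S`. -/
def IsMGUSys (σ : Subst Sg ar) (S : List (Tm Sg ar × Tm Sg ar)) : Prop :=
  UnifiesSys σ S ∧ ∀ τ, UnifiesSys τ S → ∃ ρ, ∀ n, τ n = subst ρ (σ n)

/-- `σ` is an `H`-unifier (modulo the theory generated by `A`) of the system `S`. -/
def HUnifier (A : Tm Sg ar → Tm Sg ar → Prop) (σ : Subst Sg ar)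
    (S : List (Tm Sg ar × Tm Sg ar)) : Prop :=
  ∀ e ∈ S, EqTh A (subst σ e.1) (subst σ e.2)

/-- Narrowing: `t ⤳ t'` with substitution `σ`, using a rule `l → r` of `R` at a
non-variable position `p` of `t`, where `σ = mgu(t|_p, l)`. -/
def Narrow (R : Tm Sg ar → Tm Sg ar → Prop) (t : Tm Sg ar) (σ : Subst Sg ar)
    (t' : Tm Sg ar) : Prop :=
  ∃ l r p u, R l r ∧ subtermAt t p = some u ∧ ¬ isVar u ∧ IsMGU σ u l ∧
    t' = replaceAt (subst σ t) p (subst σ r)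

/-- The non-variable positions of a term. -/
def nonVarPos (t : Tm Sg ar) : Set (List ℕ) :=
  {p | ∃ u, subtermAt t p = some u ∧ ¬ isVar u}

/-- A configuration for basic narrowing: a term with its set of basic positions. -/
abbrev Conf (Sg : Type) (ar : Sg → ℕ) := Tm Sg ar × Set (List ℕ)

/-- One basic narrowing step: narrowing at a basic position; the basic positions
of the result are those of the source not below the redex position `p`,
together with `p·q` for `q` a non-variable position of the right-hand side. -/
def BNStep (R : Tm Sg ar → Tm Sg ar → Prop) (c : Conf Sg ar) (σ : Subst Sg ar)
    (c' : Conf Sg ar) : Prop :=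
  ∃ l r p u, R l r ∧ p ∈ c.2 ∧ subtermAt c.1 p = some u ∧ ¬ isVar u ∧ IsMGU σ u l ∧
    c'.1 = replaceAt (subst σ c.1) p (subst σ r) ∧
    c'.2 = {q | q ∈ c.2 ∧ ¬ (p <+: q)} ∪ {q | ∃ q', q = p ++ q' ∧ q' ∈ nonVarPos r}

/-- Sequences of basic narrowing steps, recording the composed substitution. -/
inductive BN (R : Tm Sg ar → Tm Sg ar → Prop) : Conf Sg ar → Subst Sg ar → Conf Sg ar → Prop where
  | refl : ∀ c, BN R c Tm.var c
  | step : ∀ {c c' c'' : Conf Sg ar} {σ θ : Subst Sg ar},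
      BNStep R c σ c' → BN R c' θ c'' → BN R c (scomp θ σ) c''

/-- Basic narrowing between terms, starting with all non-variable positions basic. -/
def BNTerms (R : Tm Sg ar → Tm Sg ar → Prop) (t : Tm Sg ar) (σ : Subst Sg ar)
    (t' : Tm Sg ar) : Prop :=
  ∃ B, BN R (t, nonVarPos t) σ (t', B)

/-! ### Intruder deduction systems -/

/-- An intruder deduction rule `l ↠ r`: a set of premises and a conclusion. -/
abbrev Rule (Sg : Type) (ar : Sg → ℕ) := Set (Tm Sg ar) × Tm Sg ar

/-- One deduction step modulo the equational theory generated by `A`. -/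
def DedStep (L : Set (Rule Sg ar)) (A : Tm Sg ar → Tm Sg ar → Prop)
    (E F : Set (Tm Sg ar)) : Prop :=
  ∃ l r σ r', (l, r) ∈ L ∧ (∀ u ∈ l, ∃ u' ∈ E, EqTh A (subst σ u) u') ∧
    EqTh A (subst σ r) r' ∧ F = E ∪ {r'}

/-- `t` is derivable from `E` modulo `A`. -/
def Deriv (L : Set (Rule Sg ar)) (A : Tm Sg ar → Tm Sg ar → Prop)
    (E : Set (Tm Sg ar)) (t : Tm Sg ar) : Prop :=
  ∃ F, Relation.ReflTransGen (DedStep L A) E F ∧ t ∈ F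

/-- One deduction step modulo the empty equational theory. -/
def DedStepSyn (L : Set (Rule Sg ar)) (E F : Set (Tm Sg ar)) : Prop :=
  ∃ l r σ, (l, r) ∈ L ∧ (∀ u ∈ l, subst σ u ∈ E) ∧ F = E ∪ {subst σ r}

/-- `t` is derivable from `E` modulo the empty theory. -/
def DerivSyn (L : Set (Rule Sg ar)) (E : Set (Tm Sg ar)) (t : Tm Sg ar) : Prop :=
  ∃ F, Relation.ReflTransGen (DedStepSyn L) E F ∧ t ∈ F

/-! ### Constraint systems -/

/-- A constraint system with variable right-hand sides: a sequence of pairs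
`(E_i, v_i)` of a finite knowledge set and a variable. -/
abbrev CSys (Sg : Type) (ar : Sg → ℕ) := List (List (Tm Sg ar) × ℕ)

/-- A general (extended) constraint system: deduction constraints `E_i ▷ t_i`. -/
abbrev GCS (Sg : Type) (ar : Sg → ℕ) := List (List (Tm Sg ar) × Tm Sg ar)

/-- The set of instances by `σ` of the members of `E`. -/
def substList (σ : Subst Sg ar) (E : List (Tm Sg ar)) : Set (Tm Sg ar) :=
  {u | ∃ e ∈ E, u = subst σ e}

/-- Well-formedness of a constraint system `((E_i ▷ v_i))_i`: knowledge
monotonicity and origination of variables. -/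
def WFC (C : CSys Sg ar) : Prop :=
  (∀ i j (hi : i < C.length) (hj : j < C.length), i ≤ j →
     ∀ u ∈ (C.get ⟨i, hi⟩).1, u ∈ (C.get ⟨j, hj⟩).1) ∧
  (∀ i (hi : i < C.length), ∀ u ∈ (C.get ⟨i, hi⟩).1, ∀ x ∈ vars u,
     ∃ j, ∃ hj : j < C.length, j < i ∧ (C.get ⟨j, hj⟩).2 = x)

/-- Well-formedness of a general constraint system `((E_i ▷ t_i))_i`. -/
def WFG (C : GCS Sg ar) : Prop :=
  (∀ i j (hi : i < C.length) (hj : j < C.length), i ≤ j →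
     ∀ u ∈ (C.get ⟨i, hi⟩).1, u ∈ (C.get ⟨j, hj⟩).1) ∧
  (∀ i (hi : i < C.length), ∀ u ∈ (C.get ⟨i, hi⟩).1, ∀ x ∈ vars u,
     ∃ j, ∃ hj : j < C.length, j < i ∧ (C.get ⟨j, hj⟩).2 = Tm.var x)

/-- `σ` satisfies the constraint system `(C, S)` in the intruder system given by
deduction rules `L` modulo the theory generated by `A`. -/
def SatC (L : Set (Rule Sg ar)) (A : Tm Sg ar → Tm Sg ar → Prop)
    (σ : Subst Sg ar) (C : CSys Sg ar) (S : List (Tm Sg ar × Tm Sg ar)) : Prop :=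
  (∀ p ∈ C, Deriv L A (substList σ p.1) (σ p.2)) ∧ HUnifier A σ S

/-- `σ` satisfies the deduction constraints of `C` modulo `A`. -/
def SatG (L : Set (Rule Sg ar)) (A : Tm Sg ar → Tm Sg ar → Prop)
    (σ : Subst Sg ar) (C : GCS Sg ar) : Prop :=
  ∀ p ∈ C, Deriv L A (substList σ p.1) (subst σ p.2)

/-- `σ` satisfies the deduction constraints of `C` modulo the empty theory. -/
def SatGSyn (L : Set (Rule Sg ar)) (σ : Subst Sg ar) (C : GCS Sg ar) : Prop :=
  ∀ p ∈ C, DerivSyn L (substList σ p.1) (subst σ p.2)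

/-- A general constraint system is in solved form when every right-hand side is
a variable. -/
def SolvedForm (C : GCS Sg ar) : Prop := ∀ p ∈ C, isVar p.2

/-- Viewing a constraint system with variable right-hand sides as a general one. -/
def toGCS (C : CSys Sg ar) : GCS Sg ar := C.map (fun p => (p.1, Tm.var p.2))

/-- Componentwise basic narrowing of lists of terms. -/
def ListNarrow (R : Tm Sg ar → Tm Sg ar → Prop) (E E' : List (Tm Sg ar)) : Prop :=
  E.length = E'.length ∧
  ∀ i (h : i < E.length) (h' : i < E'.length),
    ∃ μ, BNTerms R (E.get ⟨i, h⟩) μ (E'.get ⟨i, h'⟩)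

/-- `C'` is obtained from `C` by applying basic narrowing steps to the
subterms of `C`. -/
def CNarrow (R : Tm Sg ar → Tm Sg ar → Prop) (C C' : GCS Sg ar) : Prop :=
  C.length = C'.length ∧
  ∀ i (h : i < C.length) (h' : i < C'.length),
    ListNarrow R (C.get ⟨i, h⟩).1 (C'.get ⟨i, h'⟩).1 ∧
    ∃ μ, BNTerms R (C.get ⟨i, h⟩).2 μ (C'.get ⟨i, h'⟩).2

/-! ### Saturation -/

/-- Rule `ρ` is subsumed by a rule of `L`. -/
def Subsumed (L : Set (Rule Sg ar)) (ρ : Rule Sg ar) : Prop :=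
  ∃ l1, (l1, ρ.2) ∈ L ∧ l1 ⊆ ρ.1

/-- One narrowing step on a deduction rule `(l, r)`, performed on the
conclusion or on one of the premises, instantiating the rest. -/
def RuleNarrow (R : Tm Sg ar → Tm Sg ar → Prop) (ρ ρ' : Rule Sg ar) : Prop :=
  (∃ σ r', Narrow R ρ.2 σ r' ∧ ρ' = ((subst σ) '' ρ.1, r')) ∨
  (∃ u ∈ ρ.1, ∃ σ u', Narrow R u σ u' ∧
      ρ' = (insert u' ((subst σ) '' (ρ.1 \ {u})), subst σ ρ.2))

/-- The saturation rules of Figure 1: Subsumption, Closure and Narrow. -/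
inductive SatStep (R : Tm Sg ar → Tm Sg ar → Prop) :
    Set (Rule Sg ar) → Set (Rule Sg ar) → Prop where
  | subsum : ∀ {L : Set (Rule Sg ar)} {l1 l2 : Set (Tm Sg ar)} {r : Tm Sg ar},
      (l1, r) ∈ L → (l2, r) ∈ L → l1 ⊆ l2 → l1 ≠ l2 → SatStep R L (L \ {(l2, r)})
  | closure : ∀ {L : Set (Rule Sg ar)} {l1 l2 : Set (Tm Sg ar)}
      {r1 t r2 : Tm Sg ar} {σ : Subst Sg ar},
      (l1, r1) ∈ L → (insert t l2, r2) ∈ L → ¬ isVar t → IsMGU σ r1 t →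
      SatStep R L (insert ((subst σ) '' (l1 ∪ l2), subst σ r2) L)
  | narrow : ∀ {L : Set (Rule Sg ar)} {ρ ρ' : Rule Sg ar},
      ρ ∈ L → RuleNarrow R ρ ρ' → SatStep R L (insert ρ' L)

/-- `L` is saturated: every rule produced by Closure or Narrow is subsumed. -/
def Saturated (R : Tm Sg ar → Tm Sg ar → Prop) (L : Set (Rule Sg ar)) : Prop :=
  (∀ (l1 l2 : Set (Tm Sg ar)) (r1 t r2 : Tm Sg ar) (σ : Subst Sg ar),
     (l1, r1) ∈ L → (insert t l2, r2) ∈ L → ¬ isVar t → IsMGU σ r1 t →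
     Subsumed L ((subst σ) '' (l1 ∪ l2), subst σ r2)) ∧
  (∀ ρ ∈ L, ∀ ρ', RuleNarrow R ρ ρ' → Subsumed L ρ')

/-! ### Transformation rules on constraint systems (Figure 2) -/

/-- Instantiation of a constraint system. -/
def csubst (σ : Subst Sg ar) (C : GCS Sg ar) : GCS Sg ar :=
  C.map (fun p => (p.1.map (subst σ), subst σ p.2))

/-- The transformation rules `Unif` and `Apply` of Figure 2, applied to the
first deduction constraint whose right-hand side is not a variable. -/
inductive TStep (L' : Set (Rule Sg ar)) : GCS Sg ar → GCS Sg ar → Prop where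
  | unif : ∀ {Cα Cβ : GCS Sg ar} {E : List (Tm Sg ar)} {t u : Tm Sg ar} {σ : Subst Sg ar},
      SolvedForm Cα → ¬ isVar t → u ∈ E → ¬ isVar u → IsMGU σ u t →
      TStep L' (Cα ++ (E, t) :: Cβ) (csubst σ (Cα ++ Cβ))
  | apply : ∀ {Cα Cβ : GCS Sg ar} {E : List (Tm Sg ar)} {t r : Tm Sg ar}
      {l : Set (Tm Sg ar)} {lx lnl el : List (Tm Sg ar)} {σ : Subst Sg ar},
      SolvedForm Cα → ¬ isVar t → (l, r) ∈ L' →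
      (∀ u ∈ lx, isVar u) → (∀ u, u ∈ l ↔ (u ∈ lx ∨ u ∈ lnl)) →
      el.length = lnl.length → (∀ e ∈ el, e ∈ E) →
      IsMGUSys σ ((el.zip lnl) ++ [(r, t)]) →
      TStep L' (Cα ++ (E, t) :: Cβ)
        (csubst σ (Cα ++ (lx.map (fun y => (E, y))) ++ Cβ))

/-! ### Narrowing of unification systems (for Hullot's procedure) -/

/-- An equation between two basic-narrowing configurations. -/
abbrev EqConf (Sg : Type) (ar : Sg → ℕ) := Conf Sg ar × Conf Sg ar

def csub (σ : Subst Sg ar) (e : EqConf Sg ar) : EqConf Sg ar :=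
  ((subst σ e.1.1, e.1.2), (subst σ e.2.1, e.2.2))

/-- One basic narrowing step on one side of one equation of the system, the
substitution being applied to the whole system. -/
def SysBNStep (R : Tm Sg ar → Tm Sg ar → Prop) (c : List (EqConf Sg ar))
    (σ : Subst Sg ar) (c' : List (EqConf Sg ar)) : Prop :=
  ∃ (i : Fin c.length) (side : Bool) (d : Conf Sg ar),
    BNStep R (if side then (c.get i).1 else (c.get i).2) σ d ∧
    c' = (c.map (csub σ)).set i.1
      (if side then (d, (csub σ (c.get i)).2) else ((csub σ (c.get i)).1, d))

/-- Sequences of basic narrowing steps on a unification system, recording the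
composed substitution. -/
inductive SysBN (R : Tm Sg ar → Tm Sg ar → Prop) :
    List (EqConf Sg ar) → Subst Sg ar → List (EqConf Sg ar) → Prop where
  | refl : ∀ c, SysBN R c Tm.var c
  | step : ∀ {c c' c'' : List (EqConf Sg ar)} {σ θ : Subst Sg ar},
      SysBNStep R c σ c' → SysBN R c' θ c'' → SysBN R c (scomp θ σ) c''

/-- The initial configuration of a unification system: all non-variable
positions are basic. -/
def initConf (S : List (Tm Sg ar × Tm Sg ar)) : List (EqConf Sg ar) :=
  S.map (fun e => ((e.1, nonVarPos e.1), (e.2, nonVarPos e.2)))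

/-- The substitutions output by Hullot's procedure on the system `S`: a basic
narrowing derivation followed by syntactic unification of the resulting system. -/
def ProcOutput (R : Tm Sg ar → Tm Sg ar → Prop) (S : List (Tm Sg ar × Tm Sg ar))
    (δ : Subst Sg ar) : Prop :=
  ∃ c' σ τ, SysBN R (initConf S) σ c' ∧
    IsMGUSys τ (c'.map (fun e => (e.1.1, e.2.1))) ∧ δ = scomp τ σ

/-- The size of a unification system. -/
def sysSize (S : List (Tm Sg ar × Tm Sg ar)) : ℕ :=
  (S.map (fun e => tmSize e.1 + tmSize e.2)).sum

/-- The size of a certificate (a substitution presented as a finite list). -/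
def certSize (c : List (ℕ × Tm Sg ar)) : ℕ := (c.map (fun e => tmSize e.2)).sum

/-! ### The DSKS signature -/

/-- The signature G_DSKS = {Sig, Ver, SK', PK', 0, 1, SK, PK}. -/
inductive SgD : Type | sig | ver | skp | pkp | zero | one | sk | pk

def arD : SgD → ℕ
  | .sig => 2 | .ver => 3 | .skp => 2 | .pkp => 2
  | .zero => 0 | .one => 0 | .sk => 1 | .pk => 1

abbrev TmD := Tm SgD arD

def dSig (a b : TmD) : TmD := .app .sig ![a, b]
def dVer (a b c : TmD) : TmD := .app .ver ![a, b, c]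
def dSkp (a b : TmD) : TmD := .app .skp ![a, b]
def dPkp (a b : TmD) : TmD := .app .pkp ![a, b]
def dSk (a : TmD) : TmD := .app .sk ![a]
def dPk (a : TmD) : TmD := .app .pk ![a]
def dZero : TmD := .app .zero ![]
def dOne : TmD := .app .one ![]

def xD : TmD := .var 0
def yD : TmD := .var 1
def zD : TmD := .var 2
def y1D : TmD := .var 1
def y2D : TmD := .var 2

/-- The convergent rewrite system R_DSKS. -/
inductive RDSKS : TmD → TmD → Prop where
  | r1 : RDSKS (dVer xD (dSig xD (dSk yD)) (dPk yD)) dOne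
  | r2 : RDSKS (dVer xD (dSig xD (dSkp y1D y2D)) (dPkp y1D y2D)) dOne
  | r3 : RDSKS (dVer xD (dSig xD (dSk yD)) (dPkp (dPk yD) (dSig xD (dSk yD)))) dOne
  | r4 : RDSKS (dSig xD (dSkp (dPk yD) (dSig xD (dSk yD)))) (dSig xD (dSk yD))

/-- The axioms A_DSKS presenting the equational theory H_DSKS. -/
inductive ADSKS : TmD → TmD → Prop where
  | a1 : ADSKS (dVer xD (dSig xD (dSk yD)) (dPk yD)) dOne
  | a2 : ADSKS (dVer xD (dSig xD (dSkp y1D y2D)) (dPkp y1D y2D)) dOne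
  | a3 : ADSKS (dSig xD (dSkp (dPk yD) (dSig xD (dSk yD)))) (dSig xD (dSk yD))

/-- The intruder deduction rules L_DSKS. -/
def LDSKS : Set (Rule SgD arD) :=
  { (({xD, yD} : Set TmD), dSig xD yD), (({xD, yD, zD} : Set TmD), dVer xD yD zD),
    (({xD, yD} : Set TmD), dSkp xD yD), (({xD, yD} : Set TmD), dPkp xD yD),
    ((∅ : Set TmD), dZero), ((∅ : Set TmD), dOne) }

/-- The saturated deduction rules L'_DSKS. -/
def LDSKS' : Set (Rule SgD arD) :=
  LDSKS ∪ { (({xD, dSk yD} : Set TmD), dSig xD (dSk yD)),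
            (({xD, dSkp (dPk yD) (dSig xD (dSk yD))} : Set TmD), dSig xD (dSk yD)) }

/-! ### The DEO signature -/

/-- The signature G_DEO = {Sig, Ver, SK'', PK'', f, 0, 1, SK, PK}. -/
inductive SgE : Type | sig | ver | skp | pkp | f | zero | one | sk | pk

def arE : SgE → ℕ
  | .sig => 2 | .ver => 3 | .skp => 2 | .pkp => 2 | .f => 2
  | .zero => 0 | .one => 0 | .sk => 1 | .pk => 1

abbrev TmE := Tm SgE arE

def eSig (a b : TmE) : TmE := .app .sig ![a, b]
def eVer (a b c : TmE) : TmE := .app .ver ![a, b, c]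
def eSkp (a b : TmE) : TmE := .app .skp ![a, b]
def ePkp (a b : TmE) : TmE := .app .pkp ![a, b]
def eF (a b : TmE) : TmE := .app .f ![a, b]
def eSk (a : TmE) : TmE := .app .sk ![a]
def ePk (a : TmE) : TmE := .app .pk ![a]
def eZero : TmE := .app .zero ![]
def eOne : TmE := .app .one ![]

def xE : TmE := .var 0
def yE : TmE := .var 1
def zE : TmE := .var 2
def y1E : TmE := .var 1
def y2E : TmE := .var 2

/-- The convergent rewrite system R_DEO. -/
inductive RDEO : TmE → TmE → Prop where
  | r1 : RDEO (eVer xE (eSig xE (eSk yE)) (ePk yE)) eOne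
  | r2 : RDEO (eVer xE (eSig xE (eSkp y1E y2E)) (ePkp y1E y2E)) eOne
  | r3 : RDEO (eVer (eF (ePk yE) (eSig xE (eSk yE))) (eSig xE (eSk yE))
      (ePkp (ePk yE) (eSig xE (eSk yE)))) eOne
  | r4 : RDEO (eSig (eF (ePk yE) (eSig xE (eSk yE))) (eSkp (ePk yE) (eSig xE (eSk yE))))
      (eSig xE (eSk yE))

/-- The axioms A_DEO presenting the equational theory H_DEO. -/
inductive ADEO : TmE → TmE → Prop where
  | a1 : ADEO (eVer xE (eSig xE (eSk yE)) (ePk yE)) eOne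
  | a2 : ADEO (eVer xE (eSig xE (eSkp y1E y2E)) (ePkp y1E y2E)) eOne
  | a3 : ADEO (eSig (eF (ePk yE) (eSig xE (eSk yE))) (eSkp (ePk yE) (eSig xE (eSk yE))))
      (eSig xE (eSk yE))

/-- The intruder deduction rules L_DEO. -/
def LDEO : Set (Rule SgE arE) :=
  { (({xE, yE} : Set TmE), eSig xE yE), (({xE, yE, zE} : Set TmE), eVer xE yE zE),
    (({xE, yE} : Set TmE), eSkp xE yE), (({xE, yE} : Set TmE), ePkp xE yE),
    (({xE, yE} : Set TmE), eF xE yE),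
    ((∅ : Set TmE), eZero), ((∅ : Set TmE), eOne) }

/-- The saturated deduction rules L'_DEO. -/
def LDEO' : Set (Rule SgE arE) :=
  LDEO ∪ { (({eF (ePk yE) (eSig xE (eSk yE)), eSkp (ePk yE) (eSig xE (eSk yE))} : Set TmE),
            eSig xE (eSk yE)) }


end Paper

namespace Paper

section General

variable {Sg : Type} {ar : Sg → ℕ} {R A : Tm Sg ar → Tm Sg ar → Prop}

lemma Reduces.app_update (s : Sg) (a : Fin (ar s) → Tm Sg ar) (i : Fin (ar s))
    {t u : Tm Sg ar} (h : Reduces R t u) :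
    Reduces R (.app s (Function.update a i t)) (.app s (Function.update a i u)) := by
  refine Relation.ReflTransGen.lift (fun v => Tm.app s (Function.update a i v))
    (fun v w hvw => ?_) _ _ h
  refine Rew.congr s _ _ i (by simpa using hvw) fun j hj => ?_
  simp [Function.update_of_ne hj]

lemma Reduces.app_congr (s : Sg) {a b : Fin (ar s) → Tm Sg ar}
    (h : ∀ i, Reduces R (a i) (b i)) : Reduces R (.app s a) (.app s b) := by
  classical
  have key : ∀ S : Finset (Fin (ar s)), Reduces R (.app s a) (.app s (S.piecewise b a)) := by
    intro S
    induction S using Finset.induction_on with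
    | empty =>
      rw [Finset.piecewise_empty]
      exact Relation.ReflTransGen.refl
    | insert j S hj ih =>
      refine ih.trans ?_
      rw [Finset.piecewise_insert]
      have hstep := Reduces.app_update s (S.piecewise b a) j (h j)
      rwa [← Finset.piecewise_eq_of_notMem S b a hj, Function.update_eq_self] at hstep
  simpa using key Finset.univ

lemma Rew.eqTh (hR : ∀ l r, R l r → ∀ σ, EqTh A (subst σ l) (subst σ r)) {t u : Tm Sg ar}
    (h : Rew R t u) : EqTh A t u := by
  induction h with
  | root l r σ hlr => exact hR l r hlr σ
  | congr s a b i _ hj ih =>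
    refine EqTh.congr s a b fun j => ?_
    by_cases hji : j = i
    · exact hji ▸ ih
    · exact hj j hji ▸ EqTh.refl _

lemma Reduces.eqTh (hR : ∀ l r, R l r → ∀ σ, EqTh A (subst σ l) (subst σ r)) {t u : Tm Sg ar}
    (h : Reduces R t u) : EqTh A t u := by
  induction h with
  | refl => exact EqTh.refl _
  | tail _ hs ih => exact ih.trans (hs.eqTh hR)

lemma NormalForm.eq_of_reduces {t u : Tm Sg ar} (ht : NormalForm R t) (h : Reduces R t u) :
    t = u := by
  rcases h.cases_head with h | ⟨v, hv, _⟩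
  · exact h
  · exact (ht v hv).elim

lemma Terminating.exists_normalForm (hR : Terminating R) (t : Tm Sg ar) :
    ∃ u, Reduces R t u ∧ NormalForm R u := by
  induction t using hR.induction with
  | _ t ih =>
    by_cases ht : NormalForm R t
    · exact ⟨t, Relation.ReflTransGen.refl, ht⟩
    · simp only [NormalForm, not_forall, not_not] at ht
      obtain ⟨v, hv⟩ := ht
      obtain ⟨u, hu, hn⟩ := ih v hv
      exact ⟨u, Relation.ReflTransGen.head hv hu, hn⟩

lemma Rew.tmSize_lt (hR : ∀ l r, R l r → ∀ σ, tmSize (subst σ r) < tmSize (subst σ l))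
    {t u : Tm Sg ar} (h : Rew R t u) : tmSize u < tmSize t := by
  induction h with
  | root l r σ hlr => exact hR l r hlr σ
  | congr s a b i _ hj ih =>
    simp only [tmSize]
    refine Nat.add_lt_add_left (Finset.sum_lt_sum (fun j _ => ?_) ⟨i, Finset.mem_univ i, ih⟩) 1
    by_cases hji : j = i
    · exact hji ▸ ih.le
    · rw [hj j hji]

lemma terminating_of_tmSize_lt
    (hR : ∀ l r, R l r → ∀ σ, tmSize (subst σ r) < tmSize (subst σ l)) : Terminating R :=
  Subrelation.wf (fun h => Rew.tmSize_lt hR h) (InvImage.wf tmSize wellFounded_lt)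

/-- `t` rewrites to `u` by a rule of `R` applied at the root. -/
def RootStep (R : Tm Sg ar → Tm Sg ar → Prop) (t u : Tm Sg ar) : Prop :=
  ∃ l r σ, R l r ∧ t = subst σ l ∧ u = subst σ r

open Classical in
/-- Rewrite at the root if possible. -/
noncomputable def rootReduce (R : Tm Sg ar → Tm Sg ar → Prop) (t : Tm Sg ar) : Tm Sg ar :=
  if h : ∃ u, RootStep R t u then h.choose else t

/-- Innermost normalization, with a single root step attempted at each node. -/
noncomputable def innermost (R : Tm Sg ar → Tm Sg ar → Prop) : Tm Sg ar → Tm Sg ar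
  | .var n => .var n
  | .cst c => .cst c
  | .app s a => rootReduce R (.app s fun i => innermost R (a i))

lemma rootReduce_eq_self {t : Tm Sg ar} (h : ∀ u, ¬ RootStep R t u) : rootReduce R t = t :=
  dif_neg fun ⟨u, hu⟩ => h u hu

lemma rootReduce_spec (R : Tm Sg ar → Tm Sg ar → Prop) (t : Tm Sg ar) :
    rootReduce R t = t ∨ RootStep R t (rootReduce R t) := by
  by_cases h : ∃ u, RootStep R t u
  · right
    rw [rootReduce, dif_pos h]
    exact h.choose_spec
  · exact .inl (dif_neg h)

lemma reduces_rootReduce (t : Tm Sg ar) : Reduces R t (rootReduce R t) := by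
  rcases rootReduce_spec R t with h | ⟨l, r, σ, hlr, ht, hu⟩
  · rw [h]
    exact Relation.ReflTransGen.refl
  · rw [hu, ht]
    exact Relation.ReflTransGen.single (Rew.root l r σ hlr)

lemma reduces_innermost (t : Tm Sg ar) : Reduces R t (innermost R t) := by
  induction t with
  | var n => exact Relation.ReflTransGen.refl
  | cst c => exact Relation.ReflTransGen.refl
  | app s a ih => exact (Reduces.app_congr s ih).trans (reduces_rootReduce _)

lemma EqTh.innermost_eq
    (hA : ∀ l r, A l r → ∀ σ, innermost R (subst σ l) = innermost R (subst σ r))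
    {t u : Tm Sg ar} (h : EqTh A t u) : innermost R t = innermost R u := by
  induction h with
  | ax l r σ hlr => exact hA l r hlr σ
  | refl t => rfl
  | symm _ ih => exact ih.symm
  | trans _ _ ih₁ ih₂ => exact ih₁.trans ih₂
  | congr s a b _ ih => simp only [innermost, ih]

/-- A terminating system whose innermost normalization is invariant under an equational
theory containing it is convergent and generates that theory. -/
theorem convergent_and_generates (hR : Terminating R)
    (hRA : ∀ l r, R l r → ∀ σ, EqTh A (subst σ l) (subst σ r))
    (hA : ∀ l r, A l r → ∀ σ, innermost R (subst σ l) = innermost R (subst σ r)) :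
    Convergent R ∧ ∀ s t, EqTh A s t ↔ ∃ u, Reduces R s u ∧ Reduces R t u ∧ NormalForm R u := by
  refine ⟨⟨hR, fun a b c hb hc => ⟨innermost R b, reduces_innermost b, ?_⟩⟩, fun s t => ⟨?_, ?_⟩⟩
  · rw [((hb.eqTh hRA).symm.trans (hc.eqTh hRA)).innermost_eq hA]
    exact reduces_innermost c
  · intro h
    obtain ⟨u, hsu, hu⟩ := hR.exists_normalForm s
    obtain ⟨v, htv, hv⟩ := hR.exists_normalForm t
    have huv := (((hsu.eqTh hRA).symm.trans h).trans (htv.eqTh hRA)).innermost_eq hA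
    rw [← hu.eq_of_reduces (reduces_innermost u),
      ← hv.eq_of_reduces (reduces_innermost v)] at huv
    exact ⟨u, hsu, huv ▸ htv, hu⟩
  · rintro ⟨u, hs, ht, -⟩
    exact (hs.eqTh hRA).trans (ht.eqTh hRA).symm

end General

section Signature

variable (σ : Subst SgE arE) (R : TmE → TmE → Prop) (a b c d p q : TmE)

lemma app_one_ext {α : Type} {F G : Fin 1 → α} (h : F 0 = G 0) : F = G := by
  funext i; fin_cases i; exact h

lemma app_two_ext {α : Type} {F G : Fin 2 → α} (h₀ : F 0 = G 0) (h₁ : F 1 = G 1) : F = G := by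
  funext i; fin_cases i <;> assumption

lemma app_three_ext {α : Type} {F G : Fin 3 → α} (h₀ : F 0 = G 0) (h₁ : F 1 = G 1)
    (h₂ : F 2 = G 2) : F = G := by
  funext i; fin_cases i <;> assumption

lemma eSig_inj : eSig a b = eSig c d ↔ a = c ∧ b = d := by
  refine ⟨fun h => ?_, by rintro ⟨rfl, rfl⟩; rfl⟩
  injection h with _ h
  exact ⟨congrFun h (0 : Fin 2), congrFun h (1 : Fin 2)⟩

lemma eSkp_inj : eSkp a b = eSkp c d ↔ a = c ∧ b = d := by
  refine ⟨fun h => ?_, by rintro ⟨rfl, rfl⟩; rfl⟩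
  injection h with _ h
  exact ⟨congrFun h (0 : Fin 2), congrFun h (1 : Fin 2)⟩

lemma eF_inj : eF a b = eF c d ↔ a = c ∧ b = d := by
  refine ⟨fun h => ?_, by rintro ⟨rfl, rfl⟩; rfl⟩
  injection h with _ h
  exact ⟨congrFun h (0 : Fin 2), congrFun h (1 : Fin 2)⟩

lemma subst_eSig : subst σ (eSig a b) = eSig (subst σ a) (subst σ b) :=
  congrArg (Tm.app SgE.sig) (app_two_ext rfl rfl)

lemma subst_eVer : subst σ (eVer a b c) = eVer (subst σ a) (subst σ b) (subst σ c) :=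
  congrArg (Tm.app SgE.ver) (app_three_ext rfl rfl rfl)

lemma subst_eSkp : subst σ (eSkp a b) = eSkp (subst σ a) (subst σ b) :=
  congrArg (Tm.app SgE.skp) (app_two_ext rfl rfl)

lemma subst_ePkp : subst σ (ePkp a b) = ePkp (subst σ a) (subst σ b) :=
  congrArg (Tm.app SgE.pkp) (app_two_ext rfl rfl)

lemma subst_eF : subst σ (eF a b) = eF (subst σ a) (subst σ b) :=
  congrArg (Tm.app SgE.f) (app_two_ext rfl rfl)

lemma subst_eSk : subst σ (eSk a) = eSk (subst σ a) :=
  congrArg (Tm.app SgE.sk) (app_one_ext rfl)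

lemma subst_ePk : subst σ (ePk a) = ePk (subst σ a) :=
  congrArg (Tm.app SgE.pk) (app_one_ext rfl)

lemma subst_eOne : subst σ eOne = eOne :=
  congrArg (Tm.app SgE.one) (funext fun i => Fin.elim0 i)

lemma innermost_eSig :
    innermost R (eSig a b) = rootReduce R (eSig (innermost R a) (innermost R b)) :=
  congrArg (fun F => rootReduce R (Tm.app SgE.sig F)) (app_two_ext rfl rfl)

lemma innermost_eVer : innermost R (eVer a b c) =
    rootReduce R (eVer (innermost R a) (innermost R b) (innermost R c)) :=
  congrArg (fun F => rootReduce R (Tm.app SgE.ver F)) (app_three_ext rfl rfl rfl)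

lemma innermost_eSkp :
    innermost R (eSkp a b) = rootReduce R (eSkp (innermost R a) (innermost R b)) :=
  congrArg (fun F => rootReduce R (Tm.app SgE.skp F)) (app_two_ext rfl rfl)

lemma innermost_ePkp :
    innermost R (ePkp a b) = rootReduce R (ePkp (innermost R a) (innermost R b)) :=
  congrArg (fun F => rootReduce R (Tm.app SgE.pkp F)) (app_two_ext rfl rfl)

lemma innermost_eF :
    innermost R (eF a b) = rootReduce R (eF (innermost R a) (innermost R b)) :=
  congrArg (fun F => rootReduce R (Tm.app SgE.f F)) (app_two_ext rfl rfl)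

lemma innermost_eSk : innermost R (eSk a) = rootReduce R (eSk (innermost R a)) :=
  congrArg (fun F => rootReduce R (Tm.app SgE.sk F)) (app_one_ext rfl)

lemma innermost_ePk : innermost R (ePk a) = rootReduce R (ePk (innermost R a)) :=
  congrArg (fun F => rootReduce R (Tm.app SgE.pk F)) (app_one_ext rfl)

lemma innermost_eOne : innermost R eOne = rootReduce R eOne :=
  congrArg (fun F => rootReduce R (Tm.app SgE.one F)) (funext fun i => Fin.elim0 i)

lemma tmSize_eSig : tmSize (eSig a b) = 1 + (tmSize a + tmSize b) :=
  congrArg (1 + ·) (Fin.sum_univ_two (fun i => tmSize (![a, b] i)))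

lemma tmSize_eVer : tmSize (eVer a b c) = 1 + (tmSize a + tmSize b + tmSize c) :=
  congrArg (1 + ·) (Fin.sum_univ_three (fun i => tmSize (![a, b, c] i)))

lemma tmSize_eF : tmSize (eF a b) = 1 + (tmSize a + tmSize b) :=
  congrArg (1 + ·) (Fin.sum_univ_two (fun i => tmSize (![a, b] i)))

lemma tmSize_eOne : tmSize eOne = 1 := rfl

end Signature

/-- A root step of `RDEO` erases a verification to `1`, or simplifies a signature. -/
lemma rootStep_RDEO {t u : TmE} (h : RootStep RDEO t u) :
    ((∃ a b c, t = eVer a b c) ∧ u = eOne) ∨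
    ∃ x y, t = eSig (eF (ePk y) (eSig x (eSk y))) (eSkp (ePk y) (eSig x (eSk y))) ∧
      u = eSig x (eSk y) := by
  obtain ⟨l, r, σ, hlr, rfl, rfl⟩ := h
  cases hlr <;>
    simp only [subst_eVer, subst_eSig, subst_eF, subst_eSkp, subst_ePkp, subst_eSk, subst_ePk,
      subst_eOne]
  · exact .inl ⟨⟨_, _, _, rfl⟩, trivial⟩
  · exact .inl ⟨⟨_, _, _, rfl⟩, trivial⟩
  · exact .inl ⟨⟨_, _, _, rfl⟩, trivial⟩
  · exact .inr ⟨_, _, rfl, rfl⟩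

lemma eVer_ne_eSig (a b c d e : TmE) : eVer a b c ≠ eSig d e := by
  intro h
  injection h with h
  cases h

lemma eSk_ne_eSkp (a b c : TmE) : eSk a ≠ eSkp b c := by
  intro h
  injection h with h
  cases h

lemma rootReduce_RDEO_app (s : SgE) (hv : s ≠ .ver) (hs : s ≠ .sig) (a : Fin (arE s) → TmE) :
    rootReduce RDEO (.app s a) = .app s a := by
  refine rootReduce_eq_self fun u hu => ?_
  rcases rootStep_RDEO hu with ⟨⟨_, _, _, h⟩, -⟩ | ⟨_, _, h, -⟩
  · injection h with h
    exact hv h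
  · injection h with h
    exact hs h

lemma rootReduce_RDEO_eSig_eSk (x y : TmE) :
    rootReduce RDEO (eSig x (eSk y)) = eSig x (eSk y) := by
  refine rootReduce_eq_self fun u hu => ?_
  rcases rootStep_RDEO hu with ⟨⟨_, _, _, h⟩, -⟩ | ⟨_, _, h, -⟩
  · exact eVer_ne_eSig _ _ _ _ _ h.symm
  · exact eSk_ne_eSkp _ _ _ ((eSig_inj _ _ _ _).1 h).2

lemma rootReduce_RDEO_eq_one {a b c u : TmE} (h : RootStep RDEO (eVer a b c) u) :
    rootReduce RDEO (eVer a b c) = eOne := by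
  have hv : RootStep RDEO (eVer a b c) (rootReduce RDEO (eVer a b c)) := by
    have he : ∃ u, RootStep RDEO (eVer a b c) u := ⟨u, h⟩
    rw [rootReduce, dif_pos he]
    exact he.choose_spec
  rcases rootStep_RDEO hv with ⟨-, h⟩ | ⟨_, _, h, -⟩
  · exact h
  · exact (eVer_ne_eSig _ _ _ _ _ h).elim

/-- The substitution sending the variables `0`, `1` and `2` to `x`, `y` and `z`. -/
def substThree (x y z : TmE) : Subst SgE arE
  | 0 => x
  | 1 => y
  | 2 => z
  | n => .var n

lemma rootReduce_RDEO_eVer_sk (x y : TmE) :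
    rootReduce RDEO (eVer x (eSig x (eSk y)) (ePk y)) = eOne := by
  refine rootReduce_RDEO_eq_one (u := eOne) ⟨_, _, substThree x y x, RDEO.r1, ?_, ?_⟩
  · simp only [subst_eVer, subst_eSig, subst_eSk, subst_ePk]
    rfl
  · exact (subst_eOne _).symm

lemma rootReduce_RDEO_eVer_skp (x y z : TmE) :
    rootReduce RDEO (eVer x (eSig x (eSkp y z)) (ePkp y z)) = eOne := by
  refine rootReduce_RDEO_eq_one (u := eOne) ⟨_, _, substThree x y z, RDEO.r2, ?_, ?_⟩
  · simp only [subst_eVer, subst_eSig, subst_eSkp, subst_ePkp]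
    rfl
  · exact (subst_eOne _).symm

lemma rootReduce_RDEO_eVer_f (x y : TmE) :
    rootReduce RDEO (eVer (eF (ePk y) (eSig x (eSk y))) (eSig x (eSk y))
      (ePkp (ePk y) (eSig x (eSk y)))) = eOne := by
  refine rootReduce_RDEO_eq_one (u := eOne) ⟨_, _, substThree x y x, RDEO.r3, ?_, ?_⟩
  · simp only [subst_eVer, subst_eSig, subst_eF, subst_ePkp, subst_eSk, subst_ePk]
    rfl
  · exact (subst_eOne _).symm

lemma rootReduce_RDEO_eSig_f (x y : TmE) :
    rootReduce RDEO (eSig (eF (ePk y) (eSig x (eSk y))) (eSkp (ePk y) (eSig x (eSk y)))) =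
      eSig x (eSk y) := by
  have he : ∃ u, RootStep RDEO
      (eSig (eF (ePk y) (eSig x (eSk y))) (eSkp (ePk y) (eSig x (eSk y)))) u := by
    refine ⟨eSig x (eSk y), _, _, substThree x y x, RDEO.r4, ?_, ?_⟩ <;>
      (simp only [subst_eSig, subst_eF, subst_eSkp, subst_eSk, subst_ePk]; rfl)
  have hv := he.choose_spec
  rw [rootReduce, dif_pos he]
  rcases rootStep_RDEO hv with ⟨⟨_, _, _, h⟩, -⟩ | ⟨x', y', h, h'⟩
  · exact (eVer_ne_eSig _ _ _ _ _ h.symm).elim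
  · rw [h']
    exact ((eF_inj _ _ _ _).1 ((eSig_inj _ _ _ _).1 h).1).2.symm

lemma innermost_RDEO_of_ADEO {l r : TmE} (h : ADEO l r) (σ : Subst SgE arE) :
    innermost RDEO (subst σ l) = innermost RDEO (subst σ r) := by
  have hsk (a : TmE) : rootReduce RDEO (eSk a) = eSk a := rootReduce_RDEO_app .sk nofun nofun _
  have hpk (a : TmE) : rootReduce RDEO (ePk a) = ePk a := rootReduce_RDEO_app .pk nofun nofun _
  have hskp (a b : TmE) : rootReduce RDEO (eSkp a b) = eSkp a b :=
    rootReduce_RDEO_app .skp nofun nofun _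
  have hpkp (a b : TmE) : rootReduce RDEO (ePkp a b) = ePkp a b :=
    rootReduce_RDEO_app .pkp nofun nofun _
  have hf (a b : TmE) : rootReduce RDEO (eF a b) = eF a b := rootReduce_RDEO_app .f nofun nofun _
  have hone : rootReduce RDEO eOne = eOne := rootReduce_RDEO_app .one nofun nofun _
  cases h <;>
    simp only [subst_eVer, subst_eSig, subst_eF, subst_eSkp, subst_ePkp, subst_eSk, subst_ePk,
      subst_eOne, innermost_eVer, innermost_eSig, innermost_eF, innermost_eSkp, innermost_ePkp,
      innermost_eSk, innermost_ePk, innermost_eOne, hsk, hpk, hskp, hpkp, hf, hone,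
      rootReduce_RDEO_eSig_eSk, rootReduce_RDEO_eVer_sk, rootReduce_RDEO_eSig_f]
  generalize innermost RDEO (subst σ xE) = x
  generalize innermost RDEO (subst σ y1E) = y
  generalize innermost RDEO (subst σ y2E) = z
  rcases rootReduce_spec RDEO (eSig x (eSkp y z)) with h | h
  · rw [h, rootReduce_RDEO_eVer_skp]
  · rcases rootStep_RDEO h with ⟨⟨_, _, _, h⟩, -⟩ | ⟨x', y', h, h'⟩
    · exact (eVer_ne_eSig _ _ _ _ _ h.symm).elim
    · rw [h']
      obtain ⟨rfl, hyz⟩ := (eSig_inj _ _ _ _).1 h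
      obtain ⟨rfl, rfl⟩ := (eSkp_inj _ _ _ _).1 hyz
      exact rootReduce_RDEO_eVer_f x' y'

lemma eqTh_ADEO_of_RDEO {l r : TmE} (h : RDEO l r) (σ : Subst SgE arE) :
    EqTh ADEO (subst σ l) (subst σ r) := by
  cases h with
  | r1 => exact EqTh.ax _ _ σ .a1
  | r2 => exact EqTh.ax _ _ σ .a2
  | r4 => exact EqTh.ax _ _ σ .a3
  | r3 =>
    have hsig := EqTh.ax _ _ σ ADEO.a3
    have hver := EqTh.ax _ _ (substThree (subst σ (eF (ePk yE) (eSig xE (eSk yE))))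
      (subst σ (ePk yE)) (subst σ (eSig xE (eSk yE)))) ADEO.a2
    simp only [subst_eVer, subst_eSig, subst_eF, subst_eSkp, subst_ePkp, subst_eSk, subst_ePk,
      subst_eOne] at hsig hver ⊢
    refine EqTh.trans (EqTh.congr SgE.ver _ _ fun i => ?_) hver
    change Fin 3 at i
    fin_cases i
    · exact EqTh.refl _
    · exact hsig.symm
    · exact EqTh.refl _

lemma terminating_RDEO : Terminating RDEO := by
  refine terminating_of_tmSize_lt fun l r h σ => ?_
  cases h <;>
    simp only [subst_eVer, subst_eSig, subst_eF, subst_eOne, tmSize_eVer, tmSize_eSig, tmSize_eF,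
      tmSize_eOne] <;>
    omega

/-- the rewrite system R_DEO is convergent (terminating and
confluent) and generates the equational theory H_DEO: two terms are equal
modulo H_DEO if and only if they have the same R_DEO-normal form. -/
theorem RDEO_convergent_and_generates_HDEO :
    Convergent RDEO ∧
    ∀ s t : TmE, EqTh ADEO s t ↔
      ∃ u, Reduces RDEO s u ∧ Reduces RDEO t u ∧ NormalForm RDEO u :=
  convergent_and_generates terminating_RDEO (fun _ _ => eqTh_ADEO_of_RDEO)
    (fun _ _ => innermost_RDEO_of_ADEO)

end Paper
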